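/- Fix integers t ≥ s ≥ 2 and set ε₀ = 1/(50000·s²). There exist a constant c = c(s,t) > 0 and k₀ = k₀(s,t) such that for every integer k ≥ k₀ the following holds: let G₀ be a graph with clique number ω(G₀) ≤ k and average degree d(G₀) = d₀ ≥ k^{1000t}, such that Δ(G₀) ≤ d₀^{1+ε₀} and G₀ has no induced subgraph isomorphic to the complete bipartite graph K_{s,t}. Then G₀ contains an induced subgraph which is the 1-subdivision of an s-uniform multihypergraph 𝓗 with average degree d(𝓗) ≥ c · d₀^{1/(40000s)}. -/

import Mathlib

open Finset

/-- The average degree `2|E|/|V|` of a finite simple graph. -/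
noncomputable def avgDeg {V : Type*} [Fintype V] (G : SimpleGraph V) : ℝ :=
  2 * G.edgeSet.ncard / Fintype.card V

/-- The degree of a vertex. -/
noncomputable def deg {V : Type*} (G : SimpleGraph V) (v : V) : ℕ :=
  (G.neighborSet v).ncard

/-- `G` contains `K_{s,s}` as a (not necessarily induced) subgraph. -/
def HasKssSubgraph {V : Type*} (G : SimpleGraph V) (s : ℕ) : Prop :=
  ∃ f : completeBipartiteGraph (Fin s) (Fin s) →g G, Function.Injective f

/-- `G` contains no cycle of length 4, even as a non-induced subgraph. -/
def C4Free {V : Type*} (G : SimpleGraph V) : Prop :=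
  ¬ ∃ a b c d : V, a ≠ b ∧ a ≠ c ∧ a ≠ d ∧ b ≠ c ∧ b ≠ d ∧ c ≠ d ∧
      G.Adj a b ∧ G.Adj b c ∧ G.Adj c d ∧ G.Adj d a

/-- The balanced subdivision of `K_h` in which every edge of `K_h` is replaced by a
path with exactly `ℓ` edges (intended for `ℓ ≥ 2`): branch vertices are `Fin h`,
and each pair `a < b` gets a path of `ℓ - 1` new internal vertices. -/
def balancedSubdivision (h ℓ : ℕ) :
    SimpleGraph (Fin h ⊕ ({p : Fin h × Fin h // p.1 < p.2} × Fin (ℓ - 1))) :=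
  SimpleGraph.fromRel (fun x y =>
    match x, y with
    | Sum.inl u, Sum.inr ⟨⟨⟨a, b⟩, _⟩, i⟩ => (u = a ∧ (i : ℕ) = 0) ∨ (u = b ∧ (i : ℕ) = ℓ - 2)
    | Sum.inr ⟨e, i⟩, Sum.inr ⟨e', j⟩ => e = e' ∧ (j : ℕ) = (i : ℕ) + 1
    | _, _ => False)

/-- `G` contains an induced proper balanced subdivision of `K_h`. -/
def HasInducedBalancedSubdivision {V : Type*} (G : SimpleGraph V) (h : ℕ) : Prop :=
  ∃ ℓ : ℕ, 2 ≤ ℓ ∧ Nonempty (balancedSubdivision h ℓ ↪g G)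

/-- The number of edges of `G` with one endpoint in `A` and the other in `B`
(for disjoint `A`, `B`). -/
noncomputable def crossEdges {V : Type*} (G : SimpleGraph V) (A B : Set V) : ℕ :=
  Set.ncard {p : V × V | p.1 ∈ A ∧ p.2 ∈ B ∧ G.Adj p.1 p.2}

/-- `G` is `d`-degenerate: every (induced) subgraph has a vertex of degree at most `d`. -/
def Degenerate {V : Type*} (G : SimpleGraph V) (d : ℕ) : Prop :=
  ∀ s : Finset V, s.Nonempty → ∃ v ∈ s, ((s : Set V) ∩ G.neighborSet v).ncard ≤ d

/-- The 1-subdivision of the multihypergraph with hyperedges `edges e`, `e : E`,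
on vertex set `V`. -/
def oneSubdivision {E V : Type*} (edges : E → Finset V) : SimpleGraph (E ⊕ V) :=
  SimpleGraph.fromRel (fun x y =>
    match x, y with
    | Sum.inl a, Sum.inr b => b ∈ edges a
    | _, _ => False)

/-- The 1-subdivision of a simple graph `G`. -/
def graphOneSubdivision {W : Type*} (G : SimpleGraph W) : SimpleGraph (G.edgeSet ⊕ W) :=
  SimpleGraph.fromRel (fun x y =>
    match x, y with
    | Sum.inl e, Sum.inr w => w ∈ (e : Sym2 W)
    | _, _ => False)

/-- `I` is an independent set of `G`. -/
def IndepSet {V : Type*} (G : SimpleGraph V) (I : Set V) : Prop :=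
  I.Pairwise fun u v => ¬ G.Adj u v

/-- `G` has a clique on `k` vertices. -/
def HasClique {V : Type*} (G : SimpleGraph V) (k : ℕ) : Prop :=
  ∃ t : Finset V, G.IsNClique k t

section Ramsey

variable {V : Type*} [Fintype V] [DecidableEq V] {G : SimpleGraph V} [DecidableRel G.Adj]

/-- A quantitative Ramsey bound: if all cliques have at most `k` vertices, then every set of
`(k + 1) ^ b` vertices contains an independent set of size `b`. -/
theorem exists_isIndepSet_card_eq {k : ℕ} (hk : G.cliqueNum ≤ k) (b : ℕ) (X : Finset V)
    (hX : (k + 1) ^ b ≤ #X) : ∃ S ⊆ X, #S = b ∧ G.IsIndepSet (S : Set V) := by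
  induction b generalizing X with
  | zero => exact ⟨∅, by simp, by simp, by simp [SimpleGraph.IsIndepSet]⟩
  | succ b ih =>
    classical
    obtain ⟨Q, hQ⟩ := (X.powerset.filter fun Q : Finset V => G.IsClique (Q : Set V)).exists_maximal
      ⟨∅, by simp⟩
    have hQX : Q ⊆ X := by simpa using (mem_filter.1 hQ.1).1
    have hQc : G.IsClique (Q : Set V) := (mem_filter.1 hQ.1).2
    have hcover : X ⊆ Q.biUnion fun q => X.filter fun x => ¬ G.Adj q x := by
      intro x hx
      by_contra hcon
      simp only [mem_biUnion, mem_filter, hx, true_and, not_exists, not_and, not_not] at hcon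
      have hmem : insert x Q ∈ X.powerset.filter fun Q : Finset V => G.IsClique (Q : Set V) := by
        simp only [mem_filter, mem_powerset, coe_insert, SimpleGraph.isClique_insert]
        exact ⟨insert_subset hx hQX, hQc, fun y hy _ => (hcon y hy).symm⟩
      have hxQ : x ∈ Q := hQ.2 hmem (subset_insert x Q) (mem_insert_self x Q)
      exact G.loopless.irrefl x (hcon x hxQ)
    obtain ⟨q, hq, hbig⟩ : ∃ q ∈ Q, (k + 1) ^ b < #(X.filter fun x => ¬ G.Adj q x) := by
      by_contra! hcon
      have h1 := (card_le_card hcover).trans (card_biUnion_le_card_mul _ _ _ hcon)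
      have h2 : #Q ≤ k := hQc.card_le_cliqueNum.trans hk
      have h3 : 0 < (k + 1) ^ b := by positivity
      have h4 := Nat.mul_le_mul_right ((k + 1) ^ b) h2
      rw [pow_succ] at hX
      nlinarith
    obtain ⟨S, hSX, hSc, hS⟩ := ih ((X.filter fun x => ¬ G.Adj q x).erase q)
      ((Nat.le_sub_one_of_lt hbig).trans pred_card_le_card_erase)
    have hqS : q ∉ S := fun h => by simpa using hSX h
    refine ⟨insert q S, insert_subset (hQX hq) fun x hx => ?_, by simp [hqS, hSc], ?_⟩
    · exact (mem_filter.1 (mem_of_mem_erase (hSX hx))).1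
    · rw [SimpleGraph.IsIndepSet, coe_insert, Set.pairwise_insert]
      refine ⟨hS, fun x hx _ => ?_⟩
      have := (mem_filter.1 (mem_of_mem_erase (hSX hx))).2
      exact ⟨this, fun h => this h.symm⟩

/-- In a graph without induced `K_{s,t}`, independent `s`-sets have few common neighbours. -/
theorem card_lt_of_isEmpty_completeBipartite {s t k : ℕ} (hk : G.cliqueNum ≤ k)
    (hG : IsEmpty (completeBipartiteGraph (Fin s) (Fin t) ↪g G)) {S T : Finset V}
    (hS : G.IsIndepSet (S : Set V)) (hSc : #S = s) (hST : ∀ x ∈ S, ∀ y ∈ T, G.Adj x y) :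
    #T < (k + 1) ^ t := by
  by_contra! hcon
  obtain ⟨T', hT', hT'c, hT'i⟩ := exists_isIndepSet_card_eq hk t T hcon
  let f := S.equivFinOfCardEq hSc
  let g := T'.equivFinOfCardEq hT'c
  have hadj : ∀ i j, G.Adj (f.symm i : V) (g.symm j : V) := fun i j =>
    hST _ (f.symm i).2 _ (hT' (g.symm j).2)
  have indep : ∀ {Z : Finset V}, G.IsIndepSet (Z : Set V) → ∀ a b : Z, ¬ G.Adj (a : V) b :=
    fun hZ a b h => hZ a.2 b.2 h.ne h
  refine hG.elim ⟨⟨Sum.elim (fun i => (f.symm i : V)) (fun j => (g.symm j : V)), ?_⟩, ?_⟩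
  · rintro (i | i) (j | j) h
    · simpa using Subtype.ext h
    · exact absurd h (hadj i j).ne
    · exact absurd h (hadj j i).ne'
    · simpa using Subtype.ext h
  · rintro (i | i) (j | j)
    · change G.Adj (f.symm i : V) (f.symm j) ↔ _
      simpa using indep hS _ _
    · change G.Adj (f.symm i : V) (g.symm j) ↔ _
      simpa using hadj i j
    · change G.Adj (g.symm i : V) (f.symm j) ↔ _
      simpa using (hadj j i).symm
    · change G.Adj (g.symm i : V) (g.symm j) ↔ _
      simpa using indep hT'i _ _

/-- The independent `s`-subsets of `X`. -/
def indepSubsets (G : SimpleGraph V) [DecidableRel G.Adj] (s : ℕ) (X : Finset V) :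
    Finset (Finset V) :=
  (X.powersetCard s).filter fun S => ∀ x ∈ S, ∀ y ∈ S, ¬ G.Adj x y

theorem mem_indepSubsets {s : ℕ} {X S : Finset V} :
    S ∈ indepSubsets G s X ↔ (S ⊆ X ∧ #S = s) ∧ ∀ x ∈ S, ∀ y ∈ S, ¬ G.Adj x y := by
  simp [indepSubsets, mem_powersetCard]

theorem card_indepSubsets_le (s : ℕ) (X : Finset V) : #(indepSubsets G s X) ≤ #X ^ s :=
  (card_filter_le _ _).trans ((card_powersetCard _ _).trans_le (Nat.choose_le_pow _ _))

/-- Supersaturation for independent `s`-sets, in a weak form. -/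
theorem card_le_add_card_indepSubsets {s k : ℕ} (hk : G.cliqueNum ≤ k) (hs : 0 < s)
    (X : Finset V) : #X ≤ (k + 1) ^ s + #(indepSubsets G s X) := by
  induction X using Finset.strongInduction with
  | H X ih =>
    by_cases hX : #X < (k + 1) ^ s
    · omega
    obtain ⟨S, hSX, hSc, hS⟩ := exists_isIndepSet_card_eq hk s X (not_lt.1 hX)
    obtain ⟨x, hx⟩ : S.Nonempty := card_pos.1 (by omega)
    have h1 := ih (X.erase x) (erase_ssubset (hSX hx))
    have h2 : #(indepSubsets G s (X.erase x)) < #(indepSubsets G s X) := by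
      refine card_lt_card (ssubset_iff_of_subset ?_ |>.2 ⟨S, ?_, ?_⟩)
      · intro Z hZ
        rw [mem_indepSubsets] at hZ ⊢
        exact ⟨⟨hZ.1.1.trans (erase_subset _ _), hZ.1.2⟩, hZ.2⟩
      · exact mem_indepSubsets.2 ⟨⟨hSX, hSc⟩, fun a ha b hb h => hS ha hb h.ne h⟩
      · intro h
        simpa using (mem_indepSubsets.1 h).1.1 hx
    have h3 := card_erase_add_one (hSX hx)
    omega

end Ramsey

section DependentRandomChoice

theorem sum_piFinset_card_filter {α β : Type*} (r : ℕ) (U : Finset β)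
    (W : Finset α) (R : β → α → Prop) [∀ u w, Decidable (R u w)] :
    ∑ T ∈ Fintype.piFinset (fun _ : Fin r => U), #(W.filter fun w => ∀ i, R (T i) w) =
      ∑ w ∈ W, #(U.filter fun u => R u w) ^ r := by
  have := sum_card_bipartiteAbove_eq_sum_card_bipartiteBelow
    (s := Fintype.piFinset (fun _ : Fin r => U)) (t := W) (fun T w => ∀ i, R (T i) w)
  simp only [bipartiteAbove, bipartiteBelow] at this
  rw [this]
  refine sum_congr rfl fun w _ => ?_
  have h : (Fintype.piFinset (fun _ : Fin r => U)).filter (fun T => ∀ i, R (T i) w) =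
      Fintype.piFinset (fun _ : Fin r => U.filter fun u => R u w) := by
    ext T
    simp [Fintype.mem_piFinset, forall_and]
  rw [h]
  simp

variable {V : Type*} [Fintype V] [DecidableEq V] {G : SimpleGraph V} [DecidableRel G.Adj]

/-- Dependent random choice: `U` is small if its vertices have many neighbours in `W`. -/
theorem sum_card_pow_le {s k N : ℕ} (hk : G.cliqueNum ≤ k) (hs : 0 < s) (r : ℕ)
    (U W : Finset V)
    (hN : ∀ S ∈ indepSubsets G s W, #(U.filter fun u => ∀ x ∈ S, G.Adj u x) ≤ N) :
    ∑ w ∈ W, #(U.filter fun u => G.Adj u w) ^ r ≤ #U ^ r * (k + 1) ^ s + #W ^ s * N ^ r := by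
  rw [← sum_piFinset_card_filter r U W G.Adj]
  have h1 : ∀ T ∈ Fintype.piFinset (fun _ : Fin r => U),
      #(W.filter fun w => ∀ i, G.Adj (T i) w) ≤
        (k + 1) ^ s + #((indepSubsets G s W).filter fun S => ∀ i, ∀ x ∈ S, G.Adj (T i) x) := by
    intro T _
    refine (card_le_add_card_indepSubsets hk hs _).trans (Nat.add_le_add_left ?_ _)
    refine card_le_card fun S hS => ?_
    rw [mem_indepSubsets] at hS
    rw [mem_filter, mem_indepSubsets]
    exact ⟨⟨⟨hS.1.1.trans (filter_subset _ _), hS.1.2⟩, hS.2⟩,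
      fun i x hx => (mem_filter.1 (hS.1.1 hx)).2 i⟩
  refine (sum_le_sum h1).trans ?_
  rw [sum_add_distrib, sum_const, smul_eq_mul,
    sum_piFinset_card_filter r U (indepSubsets G s W) (fun u S => ∀ x ∈ S, G.Adj u x)]
  gcongr
  · simp
  · calc _ ≤ ∑ _S ∈ indepSubsets G s W, N ^ r :=
          sum_le_sum fun S hS => Nat.pow_le_pow_left (hN S hS) r
      _ ≤ _ := by
          rw [sum_const, smul_eq_mul]
          exact Nat.mul_le_mul_right _ (card_indepSubsets_le s W)

end DependentRandomChoice

section LocalSparsity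

variable {V : Type*} [Fintype V] [DecidableEq V] {G : SimpleGraph V} [DecidableRel G.Adj]

/-- In a graph of small clique number without induced `K_{s,t}`, few vertices have many neighbours
in a given set `W`. -/
theorem card_pow_le_of_le_card_filter_adj {s t k : ℕ} (hk : G.cliqueNum ≤ k) (hs : 0 < s)
    (hG : IsEmpty (completeBipartiteGraph (Fin s) (Fin t) ↪g G)) (U W : Finset V) {M h : ℝ}
    (hM : 0 < M) (hh : 0 ≤ h) (hW : (#W : ℝ) ≤ M)
    (hU : ∀ u ∈ U, h ≤ #(W.filter fun w => G.Adj u w))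
    (hbig : ((k : ℝ) + 1) ^ s + 1 ≤ M * (h / M) ^ (3 * s)) :
    (#U : ℝ) ^ (3 * s) ≤ M ^ s * (((k : ℝ) + 1) ^ t) ^ (3 * s) := by
  obtain ⟨r, hr⟩ : ∃ r, 3 * s = r + 1 := ⟨3 * s - 1, by omega⟩
  have hN : ∀ S ∈ indepSubsets G s W,
      #(U.filter fun u => ∀ x ∈ S, G.Adj u x) ≤ (k + 1) ^ t := by
    intro S hS
    rw [mem_indepSubsets] at hS
    exact (card_lt_of_isEmpty_completeBipartite hk hG (fun x hx y hy _ => hS.2 x hx y hy) hS.1.2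
      fun x hx y hy => ((mem_filter.1 hy).2 x hx).symm).le
  have hsum : (∑ w ∈ W, (#(U.filter fun u => G.Adj u w) : ℝ) ^ (3 * s)) ≤
      (#U : ℝ) ^ (3 * s) * ((k : ℝ) + 1) ^ s + (#W : ℝ) ^ s * (((k : ℝ) + 1) ^ t) ^ (3 * s) := by
    exact_mod_cast sum_card_pow_le hk hs (3 * s) U W hN
  have hcount : (#U : ℝ) * h ≤ ∑ w ∈ W, (#(U.filter fun u => G.Adj u w) : ℝ) := by
    have := sum_card_bipartiteAbove_eq_sum_card_bipartiteBelow (s := U) (t := W) G.Adj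
    simp only [bipartiteAbove, bipartiteBelow] at this
    have h2 := card_nsmul_le_sum U (fun u => (#(W.filter fun w => G.Adj u w) : ℝ)) h hU
    rw [nsmul_eq_mul] at h2
    refine h2.trans (le_of_eq ?_)
    exact_mod_cast this
  have hpow : ((#U : ℝ) * h) ^ (r + 1) ≤
      M ^ r * ∑ w ∈ W, (#(U.filter fun u => G.Adj u w) : ℝ) ^ (r + 1) := by
    have h1 : (∑ w ∈ W, (#(U.filter fun u => G.Adj u w) : ℝ)) ^ (r + 1) ≤
        (#W : ℝ) ^ r * ∑ w ∈ W, (#(U.filter fun u => G.Adj u w) : ℝ) ^ (r + 1) := by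
      rcases W.eq_empty_or_nonempty with rfl | hne
      · simp
      · have := pow_sum_div_card_le_sum_pow (s := W)
          (f := fun w => (#(U.filter fun u => G.Adj u w) : ℝ)) (fun _ _ => by positivity) r
        have hpos : (0 : ℝ) < (#W : ℝ) ^ r := by
          have := card_pos.2 hne
          positivity
        rwa [div_le_iff₀' hpos] at this
    refine (pow_le_pow_left₀ (by positivity) hcount _).trans (h1.trans ?_)
    exact mul_le_mul_of_nonneg_right (pow_le_pow_left₀ (by positivity) hW r)
      (sum_nonneg fun _ _ => by positivity)
  rw [hr] at hsum hbig ⊢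
  have hlow : (#U : ℝ) ^ (r + 1) * (M * (h / M) ^ (r + 1)) ≤
      ∑ w ∈ W, (#(U.filter fun u => G.Adj u w) : ℝ) ^ (r + 1) := by
    have hMr : 0 < M ^ r := by positivity
    rw [← mul_le_mul_iff_right₀ hMr]
    refine le_trans (le_of_eq ?_) hpow
    rw [div_pow, mul_pow]
    field_simp
    ring
  have hWM : (#W : ℝ) ^ s ≤ M ^ s := by gcongr
  have hU0 : (0 : ℝ) ≤ (#U : ℝ) ^ (r + 1) := by positivity
  have hN0 : (0 : ℝ) ≤ (((k : ℝ) + 1) ^ t) ^ (r + 1) := by positivity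
  nlinarith [mul_le_mul_of_nonneg_left hbig hU0, mul_le_mul_of_nonneg_right hWM hN0]

theorem card_indepSubsets_mul_le_succ {m : ℕ} (L : Finset V)
    (hL : ∀ x ∈ L, #(L.filter fun y => G.Adj x y) ≤ m) (j : ℕ) :
    #(indepSubsets G j L) * (#L - j * (m + 1)) ≤ (j + 1) * #(indepSubsets G (j + 1) L) := by
  set ext : Finset V → Finset V := fun S => L.filter fun x => x ∉ S ∧ ∀ y ∈ S, ¬ G.Adj y x
  have hext : ∀ S ∈ indepSubsets G j L, #L - j * (m + 1) ≤ #(ext S) := by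
    intro S hS
    rw [mem_indepSubsets] at hS
    have hsub : L ⊆ ext S ∪ S.biUnion fun y => insert y (L.filter fun x => G.Adj y x) := by
      intro x hx
      by_cases hxe : x ∈ ext S
      · exact mem_union_left _ hxe
      · refine mem_union_right _ ?_
        simp only [ext, mem_filter, hx, true_and, not_and, not_forall, not_not] at hxe
        simp only [mem_biUnion, mem_insert, mem_filter, hx, true_and]
        by_cases hxS : x ∈ S
        · exact ⟨x, hxS, Or.inl rfl⟩
        · obtain ⟨y, hy, hyx⟩ := hxe hxS
          exact ⟨y, hy, Or.inr hyx⟩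
    have h1 := (card_le_card hsub).trans (card_union_le _ _)
    have h2 := card_biUnion_le_card_mul S
      (fun y => insert y (L.filter fun x => G.Adj y x)) (m + 1) fun y hy =>
        (card_insert_le _ _).trans (Nat.add_le_add_right (hL y (hS.1.1 hy)) 1)
    rw [hS.1.2] at h2
    omega
  calc #(indepSubsets G j L) * (#L - j * (m + 1))
      ≤ ∑ S ∈ indepSubsets G j L, #(ext S) := by
        simpa using card_nsmul_le_sum _ _ _ hext
    _ = #((indepSubsets G j L).sigma ext) := (card_sigma _ _).symm
    _ ≤ #((indepSubsets G (j + 1) L).sigma fun S => S) := by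
        refine card_le_card_of_injOn (fun p => ⟨insert p.2 p.1, p.2⟩) ?_ ?_
        · rintro ⟨S, x⟩ hp
          simp only [coe_sigma, Set.mem_sigma_iff, mem_coe, mem_indepSubsets, ext,
            mem_filter] at hp ⊢
          obtain ⟨⟨⟨hSL, hSc⟩, hS⟩, hxL, hxS, hx⟩ := hp
          refine ⟨⟨⟨insert_subset hxL hSL, by simp [hxS, hSc]⟩, ?_⟩, mem_insert_self _ _⟩
          intro a ha b hb hab
          rcases mem_insert.1 ha with rfl | ha' <;> rcases mem_insert.1 hb with rfl | hb'
          · exact hab.ne rfl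
          · exact hx b hb' hab.symm
          · exact hx a ha' hab
          · exact hS a ha' b hb' hab
        · rintro ⟨S, x⟩ hp ⟨S', x'⟩ hp' heq
          simp only [coe_sigma, Set.mem_sigma_iff, mem_coe, ext, mem_filter] at hp hp'
          simp only [Sigma.mk.injEq, heq_eq_eq] at heq
          obtain ⟨h1, rfl⟩ := heq
          have h2 : S = S' := by
            rw [← erase_insert hp.2.2.1, h1, erase_insert hp'.2.2.1]
          rw [h2]
    _ = (j + 1) * #(indepSubsets G (j + 1) L) := by
        rw [card_sigma, sum_congr rfl fun S hS => (mem_indepSubsets.1 hS).1.2, sum_const,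
          smul_eq_mul, mul_comm]

/-- A sparse set contains many independent sets of a given size. -/
theorem pow_le_factorial_mul_card_indepSubsets {m : ℕ} (L : Finset V)
    (hL : ∀ x ∈ L, #(L.filter fun y => G.Adj x y) ≤ m) (s : ℕ) :
    (#L - s * (m + 1)) ^ s ≤ s.factorial * #(indepSubsets G s L) := by
  suffices h : ∀ j ≤ s, (#L - s * (m + 1)) ^ j ≤ j.factorial * #(indepSubsets G j L) from h s le_rfl
  intro j
  induction j with
  | zero =>
    intro _
    have : ∅ ∈ indepSubsets G 0 L := by simp [mem_indepSubsets]
    simpa using card_pos.2 ⟨_, this⟩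
  | succ j ih =>
    intro hj
    have h1 := ih (by omega)
    have h2 := card_indepSubsets_mul_le_succ L hL j
    have h3 : #L - s * (m + 1) ≤ #L - j * (m + 1) :=
      Nat.sub_le_sub_left (Nat.mul_le_mul_right _ (by omega)) _
    calc (#L - s * (m + 1)) ^ (j + 1)
        ≤ j.factorial * #(indepSubsets G j L) * (#L - j * (m + 1)) := by
          rw [pow_succ]
          exact Nat.mul_le_mul h1 h3
      _ ≤ j.factorial * ((j + 1) * #(indepSubsets G (j + 1) L)) := by
          rw [mul_assoc]
          exact Nat.mul_le_mul_left _ h2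
      _ = _ := by
          rw [Nat.factorial_succ]
          ring

end LocalSparsity

section IndependentSets

variable {V : Type*} [Fintype V] [DecidableEq V] {G : SimpleGraph V} [DecidableRel G.Adj]

/-- A Turán-type bound, linear in the number of vertices and of edges inside `A`. -/
theorem exists_indep_subset_of_card_adj_pairs (A : Finset V) {D : ℝ} (hD : 0 < D) :
    ∃ I ⊆ A, (∀ x ∈ I, ∀ y ∈ I, ¬ G.Adj x y) ∧
      (#A : ℝ) - #((A ×ˢ A).filter fun p => G.Adj p.1 p.2) / D ≤ (D + 1) * #I := by
  set A' := A.filter fun v => (#(A.filter fun w => G.Adj v w) : ℝ) ≤ D with hA'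
  obtain ⟨I, hI⟩ := (A'.powerset.filter fun I => ∀ x ∈ I, ∀ y ∈ I, ¬ G.Adj x y).exists_maximal
    ⟨∅, by simp⟩
  have hIA' : I ⊆ A' := by simpa using (mem_filter.1 hI.1).1
  have hIi := (mem_filter.1 hI.1).2
  refine ⟨I, hIA'.trans (filter_subset _ _), hIi, ?_⟩
  have hcover : A' ⊆ I.biUnion fun v => insert v (A.filter fun w => G.Adj v w) := by
    intro x hx
    by_contra hcon
    have hxA : x ∈ A := (mem_filter.1 hx).1
    simp only [mem_biUnion, mem_insert, mem_filter, hxA, true_and, not_exists, not_and,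
      not_or] at hcon
    have hmem : insert x I ∈ A'.powerset.filter fun I => ∀ x ∈ I, ∀ y ∈ I, ¬ G.Adj x y := by
      refine mem_filter.2 ⟨mem_powerset.2 (insert_subset hx hIA'), ?_⟩
      intro a ha b hb hab
      rcases mem_insert.1 ha with rfl | ha' <;> rcases mem_insert.1 hb with rfl | hb'
      · exact hab.ne rfl
      · exact (hcon b hb').2 hab.symm
      · exact (hcon a ha').2 hab
      · exact hIi a ha' b hb' hab
    exact (hcon x (hI.2 hmem (subset_insert x I) (mem_insert_self x I))).1 rfl
  have h1 : (#A' : ℝ) ≤ (D + 1) * #I := by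
    calc (#A' : ℝ) ≤ ∑ v ∈ I, (#(insert v (A.filter fun w => G.Adj v w)) : ℝ) := by
          exact_mod_cast (card_le_card hcover).trans card_biUnion_le
      _ ≤ ∑ _v ∈ I, (D + 1) := by
          refine sum_le_sum fun v hv => ?_
          have h := (mem_filter.1 (hIA' hv)).2
          have h' : (#(insert v (A.filter fun w => G.Adj v w)) : ℝ) ≤
              #(A.filter fun w => G.Adj v w) + 1 := by exact_mod_cast card_insert_le _ _
          linarith
      _ = _ := by rw [sum_const, nsmul_eq_mul, mul_comm]
  have h2 : (#(A.filter fun v => ¬ (#(A.filter fun w => G.Adj v w) : ℝ) ≤ D) : ℝ) * D ≤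
      #((A ×ˢ A).filter fun p => G.Adj p.1 p.2) := by
    have hcard : #((A ×ˢ A).filter fun p => G.Adj p.1 p.2) =
        ∑ v ∈ A, #(A.filter fun w => G.Adj v w) := by
      simp only [card_filter, sum_product]
    rw [hcard, ← nsmul_eq_mul]
    push_cast
    refine (card_nsmul_le_sum _ (fun v => (#(A.filter fun w => G.Adj v w) : ℝ)) D ?_).trans
      (sum_le_sum_of_subset_of_nonneg (filter_subset _ _) fun _ _ _ => by positivity)
    intro v hv
    exact (not_le.1 (mem_filter.1 hv).2).le
  have h3 : (#A : ℝ) = #A' + #(A.filter fun v => ¬ (#(A.filter fun w => G.Adj v w) : ℝ) ≤ D) := by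
    exact_mod_cast (card_filter_add_card_filter_not _).symm
  have h4 := (le_div_iff₀ hD).2 h2
  linarith

end IndependentSets

section Sampling

variable {V : Type*} [Fintype V] [DecidableEq V] {q : ℕ} [NeZero q]

/-- The probability that a random sample of density `1 / q` contains `S`. -/
theorem card_filter_forall_eq_zero (S : Finset V) :
    (#(univ.filter fun f : V → Fin q => ∀ x ∈ S, f x = 0) : ℝ) =
      (q : ℝ) ^ Fintype.card V * (q : ℝ)⁻¹ ^ #S := by
  have h1 : (univ.filter fun f : V → Fin q => ∀ x ∈ S, f x = 0) =
      Fintype.piFinset fun v => if v ∈ S then ({0} : Finset (Fin q)) else univ := by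
    ext f
    simp only [mem_filter, mem_univ, true_and, Fintype.mem_piFinset]
    refine forall_congr' fun v => ?_
    by_cases hv : v ∈ S <;> simp [hv]
  have hq : (q : ℝ) ≠ 0 := Nat.cast_ne_zero.2 (NeZero.ne q)
  rw [h1, Fintype.card_piFinset]
  push_cast
  have h2 : ∀ v, ((#(if v ∈ S then ({0} : Finset (Fin q)) else univ) : ℕ) : ℝ) =
      q * if v ∈ S then (q : ℝ)⁻¹ else 1 := by
    intro v
    by_cases hv : v ∈ S <;> simp [hv, hq]
  rw [prod_congr rfl fun v _ => h2 v, prod_mul_distrib, prod_const, prod_ite_mem, univ_inter,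
    prod_const, card_univ]

theorem card_filter_le_of_exists_subset {m : ℕ} (E : (V → Fin q) → Prop) [DecidablePred E]
    (𝒯 : Finset (Finset V)) (h𝒯 : ∀ T ∈ 𝒯, #T = m)
    (hE : ∀ f, E f → ∃ T ∈ 𝒯, ∀ x ∈ T, f x = 0) :
    (#(univ.filter E) : ℝ) ≤ (q : ℝ) ^ Fintype.card V * (#𝒯 * (q : ℝ)⁻¹ ^ m) := by
  have hsub : univ.filter E ⊆
      𝒯.biUnion fun T => univ.filter fun f : V → Fin q => ∀ x ∈ T, f x = 0 := by
    intro f hf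
    obtain ⟨T, hT, hfT⟩ := hE f (mem_filter.1 hf).2
    exact mem_biUnion.2 ⟨T, hT, by simpa using hfT⟩
  calc (#(univ.filter E) : ℝ)
      ≤ ∑ T ∈ 𝒯, (#(univ.filter fun f : V → Fin q => ∀ x ∈ T, f x = 0) : ℝ) := by
        exact_mod_cast (card_le_card hsub).trans card_biUnion_le
    _ = ∑ _T ∈ 𝒯, (q : ℝ) ^ Fintype.card V * (q : ℝ)⁻¹ ^ m :=
        sum_congr rfl fun T hT => by rw [card_filter_forall_eq_zero, h𝒯 T hT]
    _ = _ := by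
        rw [sum_const, nsmul_eq_mul]
        ring

/-- The probability that a random sample contains `S` and avoids `T`. -/
theorem le_card_filter_zero_ne_zero (S T : Finset V) (hST : Disjoint S T) :
    (q : ℝ) ^ Fintype.card V * (q : ℝ)⁻¹ ^ #S * (1 - #T * (q : ℝ)⁻¹) ≤
      #(univ.filter fun f : V → Fin q => (∀ x ∈ S, f x = 0) ∧ ∀ x ∈ T, f x ≠ 0) := by
  set E := univ.filter fun f : V → Fin q => (∀ x ∈ S, f x = 0) ∧ ∀ x ∈ T, f x ≠ 0
  have hsub : (univ.filter fun f : V → Fin q => ∀ x ∈ S, f x = 0) ⊆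
      E ∪ T.biUnion fun y => univ.filter fun f : V → Fin q => ∀ x ∈ insert y S, f x = 0 := by
    intro f hf
    have hf' := (mem_filter.1 hf).2
    by_cases hT : ∀ x ∈ T, f x ≠ 0
    · exact mem_union_left _ (by simpa [E] using ⟨hf', hT⟩)
    · push Not at hT
      obtain ⟨y, hy, hfy⟩ := hT
      refine mem_union_right _ (mem_biUnion.2 ⟨y, hy, ?_⟩)
      simpa [hfy] using hf'
  have h1 : (#(univ.filter fun f : V → Fin q => ∀ x ∈ S, f x = 0) : ℝ) ≤
      #E + ∑ y ∈ T, (#(univ.filter fun f : V → Fin q => ∀ x ∈ insert y S, f x = 0) : ℝ) := by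
    exact_mod_cast (card_le_card hsub).trans
      ((card_union_le _ _).trans (Nat.add_le_add_left card_biUnion_le _))
  have h2 : ∀ y ∈ T, (#(univ.filter fun f : V → Fin q => ∀ x ∈ insert y S, f x = 0) : ℝ) =
      (q : ℝ) ^ Fintype.card V * (q : ℝ)⁻¹ ^ #S * (q : ℝ)⁻¹ := by
    intro y hy
    rw [card_filter_forall_eq_zero, card_insert_of_notMem fun h => disjoint_left.1 hST h hy,
      pow_succ, mul_assoc]
  rw [sum_congr rfl h2, sum_const, nsmul_eq_mul, card_filter_forall_eq_zero] at h1
  linarith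

end Sampling

section SubdivisionVertices

variable {V : Type*} [Fintype V] {q : ℕ} [NeZero q] (G : SimpleGraph V) [DecidableRel G.Adj]

/-- The vertices outside the sample `f = 0` with exactly `s` neighbours in it, all of them isolated
in the sample. -/
def subdivisionVertices (s : ℕ) (f : V → Fin q) : Finset V :=
  univ.filter fun v => f v ≠ 0 ∧ #((G.neighborFinset v).filter fun x => f x = 0) = s ∧
    ∀ x, G.Adj v x → f x = 0 → ∀ y, G.Adj x y → f y ≠ 0

variable {G}

theorem mem_subdivisionVertices {s : ℕ} {f : V → Fin q} {v : V} :
    v ∈ subdivisionVertices G s f ↔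
      f v ≠ 0 ∧ #((G.neighborFinset v).filter fun x => f x = 0) = s ∧
        ∀ x, G.Adj v x → f x = 0 → ∀ y, G.Adj x y → f y ≠ 0 := by
  simp [subdivisionVertices]

variable [DecidableEq V]

theorem le_card_filter_mem_subdivisionVertices {s : ℕ} {M : ℝ}
    (hM : ∀ v, (G.degree v : ℝ) ≤ M) (hq : 2 * (1 + (s + 1) * M) ≤ q) (v : V) :
    (q : ℝ) ^ Fintype.card V * (#(indepSubsets G s (G.neighborFinset v)) * (q : ℝ)⁻¹ ^ s / 2) ≤
      #(univ.filter fun f : V → Fin q => v ∈ subdivisionVertices G s f) := by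
  set N := G.neighborFinset v with hN
  set avoid : Finset V → Finset V := fun S =>
    (insert v (N ∪ S.biUnion fun x => G.neighborFinset x)) \ S
  set E : Finset V → Finset (V → Fin q) := fun S =>
    univ.filter fun f : V → Fin q => (∀ x ∈ S, f x = 0) ∧ ∀ x ∈ avoid S, f x ≠ 0
  have hq0 : (0 : ℝ) < q := Nat.cast_pos.2 (NeZero.pos q)
  have hE : ∀ S ∈ indepSubsets G s N,
      (q : ℝ) ^ Fintype.card V * ((q : ℝ)⁻¹ ^ s / 2) ≤ #(E S) := by
    intro S hS
    rw [mem_indepSubsets] at hS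
    have h1 := le_card_filter_zero_ne_zero (q := q) S (avoid S) disjoint_sdiff
    have h2 : (#(avoid S) : ℝ) ≤ 1 + (s + 1) * M := by
      have h3 : #(avoid S) ≤ (#N + ∑ x ∈ S, G.degree x) + 1 := by
        refine (card_le_card sdiff_subset).trans ((card_insert_le _ _).trans ?_)
        refine Nat.add_le_add_right ((card_union_le _ _).trans ?_) 1
        refine Nat.add_le_add_left (card_biUnion_le.trans (le_of_eq ?_)) _
        simp
      have h4 : ∑ x ∈ S, (G.degree x : ℝ) ≤ s * M := by
        have := sum_le_card_nsmul S (fun x => (G.degree x : ℝ)) M fun x _ => hM x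
        rwa [hS.1.2, nsmul_eq_mul] at this
      have h5 : (#N : ℝ) ≤ M := by simpa [hN] using hM v
      have h6 : (#(avoid S) : ℝ) ≤ (#N + ∑ x ∈ S, (G.degree x : ℝ)) + 1 := by exact_mod_cast h3
      linarith
    have h7 : (#(avoid S) : ℝ) * (q : ℝ)⁻¹ ≤ 1 / 2 := by
      rw [← div_eq_mul_inv, div_le_iff₀ hq0]
      linarith
    refine le_trans ?_ h1
    rw [hS.1.2]
    have h8 : 0 ≤ (q : ℝ) ^ Fintype.card V * (q : ℝ)⁻¹ ^ s := by positivity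
    nlinarith
  have htrace : ∀ S ∈ indepSubsets G s N, ∀ f ∈ E S, N.filter (fun x => f x = 0) = S := by
    intro S hS f hf
    rw [mem_indepSubsets] at hS
    obtain ⟨hfS, hfa⟩ := (mem_filter.1 hf).2
    ext x
    rw [mem_filter]
    refine ⟨fun hx => ?_, fun hx => ⟨hS.1.1 hx, hfS x hx⟩⟩
    by_contra hxS
    exact hfa x (by simp [avoid, hx.1, hxS]) hx.2
  have hdisj : ((indepSubsets G s N : Finset (Finset V)) : Set (Finset V)).PairwiseDisjoint E := by
    intro S hS S' hS' hne
    refine disjoint_left.2 fun f hf hf' => hne ?_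
    rw [← htrace S hS f hf, ← htrace S' hS' f hf']
  have hsub : (indepSubsets G s N).biUnion E ⊆
      univ.filter fun f : V → Fin q => v ∈ subdivisionVertices G s f := by
    intro f hf
    obtain ⟨S, hS, hfE⟩ := mem_biUnion.1 hf
    have ht := htrace S hS f hfE
    obtain ⟨hfS, hfa⟩ := (mem_filter.1 hfE).2
    rw [mem_indepSubsets] at hS
    have hvS : v ∉ S := fun h => by simpa [hN] using hS.1.1 h
    refine mem_filter.2 ⟨mem_univ _, mem_subdivisionVertices.2 ⟨?_, ?_, ?_⟩⟩
    · exact hfa v (by simp [avoid, hvS])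
    · rw [← hN, ht, hS.1.2]
    · intro x hvx hx y hxy
      have hxS : x ∈ S := by
        rw [← ht, mem_filter]
        exact ⟨by simpa [hN] using hvx, hx⟩
      have hyS : y ∉ S := fun hy => hS.2 x hxS y hy hxy
      refine hfa y (mem_sdiff.2 ⟨mem_insert_of_mem (mem_union_right _ ?_), hyS⟩)
      exact mem_biUnion.2 ⟨x, hxS, by simpa using hxy⟩
  calc (q : ℝ) ^ Fintype.card V * (#(indepSubsets G s N) * (q : ℝ)⁻¹ ^ s / 2)
      = ∑ _S ∈ indepSubsets G s N, (q : ℝ) ^ Fintype.card V * ((q : ℝ)⁻¹ ^ s / 2) := by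
        rw [sum_const, nsmul_eq_mul]
        ring
    _ ≤ ∑ S ∈ indepSubsets G s N, (#(E S) : ℝ) := sum_le_sum hE
    _ ≤ _ := by
        rw [← Nat.cast_sum, ← card_biUnion hdisj]
        exact_mod_cast card_le_card hsub

theorem card_filter_mem_subdivisionVertices_le {s : ℕ} {M : ℝ}
    (hM : ∀ v, (G.degree v : ℝ) ≤ M) (v : V) :
    (#(univ.filter fun f : V → Fin q => v ∈ subdivisionVertices G s f) : ℝ) ≤
      (q : ℝ) ^ Fintype.card V * (M * (q : ℝ)⁻¹) ^ s := by
  refine (card_filter_le_of_exists_subset (m := s) _ ((G.neighborFinset v).powersetCard s)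
    (fun T hT => (mem_powersetCard.1 hT).2) fun f hf => ?_).trans ?_
  · refine ⟨(G.neighborFinset v).filter fun x => f x = 0, ?_, fun x hx => (mem_filter.1 hx).2⟩
    exact mem_powersetCard.2 ⟨filter_subset _ _, (mem_subdivisionVertices.1 hf).2.1⟩
  · rw [mul_pow]
    gcongr
    rw [card_powersetCard, SimpleGraph.card_neighborFinset_eq_degree]
    calc (((G.degree v).choose s : ℕ) : ℝ) ≤ (G.degree v : ℝ) ^ s := by
          exact_mod_cast Nat.choose_le_pow _ _
      _ ≤ M ^ s := by gcongr; exact hM v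

theorem card_filter_mem_subdivisionVertices_pair_le {s : ℕ} {M : ℝ}
    (hM : ∀ v, (G.degree v : ℝ) ≤ M) (u v : V)
    (huv : (#(G.neighborFinset u ∩ G.neighborFinset v) : ℝ) * q ≤ M ^ 2) :
    (#(univ.filter fun f : V → Fin q =>
        u ∈ subdivisionVertices G s f ∧ v ∈ subdivisionVertices G s f) : ℝ) ≤
      (q : ℝ) ^ Fintype.card V * ((s + 1) * (M * (q : ℝ)⁻¹) ^ (2 * s)) := by
  set C := G.neighborFinset u ∩ G.neighborFinset v with hC
  set X := G.neighborFinset u \ C with hX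
  set Y := G.neighborFinset v \ C with hY
  have hq0 : (0 : ℝ) < q := Nat.cast_pos.2 (NeZero.pos q)
  have hM0 : 0 ≤ M := (Nat.cast_nonneg _).trans (hM u)
  have hXY : Disjoint X Y := by
    rw [disjoint_left]
    intro x hx hy
    simp only [hX, hY, hC, mem_sdiff, mem_inter] at hx hy
    exact hx.2 ⟨hx.1, hy.1⟩
  set E : ℕ → (V → Fin q) → Prop := fun j f =>
    #(C.filter fun x => f x = 0) = j ∧ #(X.filter fun x => f x = 0) = s - j ∧
      #(Y.filter fun x => f x = 0) = s - j with hEdef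
  have hsplit : ∀ (w : V) (f : V → Fin q), C ⊆ G.neighborFinset w →
      w ∈ subdivisionVertices G s f →
      #(C.filter fun x => f x = 0) + #((G.neighborFinset w \ C).filter fun x => f x = 0) = s := by
    intro w f hw hf
    rw [← (mem_subdivisionVertices.1 hf).2.1, ← card_union_of_disjoint, ← filter_union,
      union_sdiff_of_subset hw]
    exact disjoint_filter_filter disjoint_sdiff
  have hsub : (univ.filter fun f : V → Fin q =>
      u ∈ subdivisionVertices G s f ∧ v ∈ subdivisionVertices G s f) ⊆
      (range (s + 1)).biUnion fun j => univ.filter (E j) := by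
    intro f hf
    obtain ⟨hu, hv⟩ := (mem_filter.1 hf).2
    have h1 := hsplit u f inter_subset_left hu
    have h2 := hsplit v f inter_subset_right hv
    rw [← hX] at h1
    rw [← hY] at h2
    refine mem_biUnion.2 ⟨#(C.filter fun x => f x = 0), mem_range.2 (by omega), ?_⟩
    refine mem_filter.2 ⟨mem_univ _, rfl, ?_, ?_⟩ <;> omega
  have hterm : ∀ j ∈ range (s + 1), (#(univ.filter (E j)) : ℝ) ≤
      (q : ℝ) ^ Fintype.card V * (M * (q : ℝ)⁻¹) ^ (2 * s) := by
    intro j hj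
    have hjs : j ≤ s := Nat.lt_succ_iff.1 (mem_range.1 hj)
    set 𝒯 : Finset (Finset V) := (C.powersetCard j ×ˢ X.powersetCard (s - j) ×ˢ
      Y.powersetCard (s - j)).image fun p => p.1 ∪ (p.2.1 ∪ p.2.2) with h𝒯
    have hcard : (#𝒯 : ℝ) ≤ (#C : ℝ) ^ j * M ^ (2 * (s - j)) := by
      have h1 : #𝒯 ≤ #C ^ j * (#X ^ (s - j) * #Y ^ (s - j)) := by
        refine card_image_le.trans ?_
        rw [card_product, card_product, card_powersetCard, card_powersetCard, card_powersetCard]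
        exact Nat.mul_le_mul (Nat.choose_le_pow _ _)
          (Nat.mul_le_mul (Nat.choose_le_pow _ _) (Nat.choose_le_pow _ _))
      have hle : ∀ w : V, (#(G.neighborFinset w \ C) : ℝ) ≤ M := fun w =>
        le_trans (by exact_mod_cast card_le_card sdiff_subset) (hM w)
      calc (#𝒯 : ℝ) ≤ (#C : ℝ) ^ j * ((#X : ℝ) ^ (s - j) * (#Y : ℝ) ^ (s - j)) := by
            exact_mod_cast h1
        _ ≤ (#C : ℝ) ^ j * (M ^ (s - j) * M ^ (s - j)) := by
            gcongr
            · exact hle u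
            · exact hle v
        _ = _ := by rw [two_mul, pow_add]
    have h𝒯card : ∀ T ∈ 𝒯, #T = 2 * s - j := by
      intro T hT
      obtain ⟨⟨J, S₁, S₂⟩, hp, rfl⟩ := mem_image.1 hT
      simp only [mem_product, mem_powersetCard] at hp
      obtain ⟨⟨hJ, hJc⟩, ⟨h₁, h₁c⟩, h₂, h₂c⟩ := hp
      have hd1 : Disjoint S₁ S₂ := disjoint_of_subset_left h₁ (disjoint_of_subset_right h₂ hXY)
      have hd2 : Disjoint J (S₁ ∪ S₂) := by
        refine disjoint_union_right.2 ⟨?_, ?_⟩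
        · exact disjoint_of_subset_left hJ (disjoint_of_subset_right h₁ disjoint_sdiff)
        · exact disjoint_of_subset_left hJ (disjoint_of_subset_right h₂ disjoint_sdiff)
      rw [card_union_of_disjoint hd2, card_union_of_disjoint hd1]
      omega
    refine (card_filter_le_of_exists_subset (E j) 𝒯 h𝒯card fun f hf => ?_).trans ?_
    · refine ⟨_, mem_image.2 ⟨(C.filter fun x => f x = 0, X.filter fun x => f x = 0,
        Y.filter fun x => f x = 0), ?_, rfl⟩, ?_⟩
      · simp only [mem_product, mem_powersetCard]
        exact ⟨⟨filter_subset _ _, hf.1⟩, ⟨filter_subset _ _, hf.2.1⟩, filter_subset _ _, hf.2.2⟩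
      · intro x hx
        simp only [mem_union, mem_filter] at hx
        tauto
    · refine mul_le_mul_of_nonneg_left ?_ (by positivity)
      have hCp : (#C : ℝ) * (q : ℝ)⁻¹ ≤ (M * (q : ℝ)⁻¹) ^ 2 := by
        rw [mul_pow, inv_pow, ← div_eq_mul_inv, ← div_eq_mul_inv, div_le_div_iff₀ hq0 (by positivity)]
        nlinarith
      calc (#𝒯 : ℝ) * (q : ℝ)⁻¹ ^ (2 * s - j)
          ≤ (#C : ℝ) ^ j * M ^ (2 * (s - j)) * (q : ℝ)⁻¹ ^ (2 * s - j) := by gcongr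
        _ = ((#C : ℝ) * (q : ℝ)⁻¹) ^ j * (M * (q : ℝ)⁻¹) ^ (2 * (s - j)) := by
            rw [show 2 * s - j = j + 2 * (s - j) by omega, pow_add, mul_pow, mul_pow]
            ring
        _ ≤ ((M * (q : ℝ)⁻¹) ^ 2) ^ j * (M * (q : ℝ)⁻¹) ^ (2 * (s - j)) := by
            refine mul_le_mul_of_nonneg_right (pow_le_pow_left₀ (by positivity) hCp j) ?_
            exact (even_two_mul _).pow_nonneg _
        _ = (M * (q : ℝ)⁻¹) ^ (2 * s) := by
            rw [← pow_mul, ← pow_add]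
            congr 1
            omega
  calc _ ≤ ∑ j ∈ range (s + 1), (#(univ.filter (E j)) : ℝ) := by
        exact_mod_cast (card_le_card hsub).trans card_biUnion_le
    _ ≤ ∑ _j ∈ range (s + 1), (q : ℝ) ^ Fintype.card V * (M * (q : ℝ)⁻¹) ^ (2 * s) :=
        sum_le_sum hterm
    _ = _ := by
        rw [sum_const, card_range, nsmul_eq_mul]
        push_cast
        ring

end SubdivisionVertices

section Assembly

/-- An induced bipartite subgraph whose first side has constant degree `s` is the 1-subdivision of
an `s`-uniform multihypergraph. -/
theorem exists_oneSubdivision_embedding {V : Type*} {G : SimpleGraph V}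
    [DecidableRel G.Adj] {s : ℕ} (A B : Finset V) (hAB : Disjoint A B)
    (hA : ∀ x ∈ A, ∀ y ∈ A, ¬ G.Adj x y) (hB : ∀ x ∈ B, ∀ y ∈ B, ¬ G.Adj x y)
    (hs : ∀ x ∈ A, #(B.filter fun y => G.Adj x y) = s) :
    ∃ edges : Fin #A → Finset (Fin #B), (∀ e, #(edges e) = s) ∧
      Nonempty (oneSubdivision edges ↪g G) := by
  let f := A.equivFin
  let g := B.equivFin
  refine ⟨fun e => univ.filter fun j => G.Adj (f.symm e) (g.symm j), fun e => ?_, ⟨⟨⟨Sum.elim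
    (fun i => (f.symm i : V)) (fun j => (g.symm j : V)), ?_⟩, ?_⟩⟩⟩
  · rw [← hs _ (f.symm e).2]
    refine card_bij (fun j _ => (g.symm j : V)) ?_ ?_ ?_
    · intro j hj
      simpa using hj
    · intro i _ j _ h
      simpa using Subtype.ext h
    · intro y hy
      obtain ⟨hyB, hy⟩ := mem_filter.1 hy
      exact ⟨g ⟨y, hyB⟩, by simpa using hy, by simp⟩
  · rintro (i | i) (j | j) h
    · simpa using Subtype.ext h
    · exact absurd h fun h : (f.symm i : V) = g.symm j =>
        disjoint_left.1 hAB (f.symm i).2 (h ▸ (g.symm j).2)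
    · exact absurd h fun h : (g.symm i : V) = f.symm j =>
        disjoint_left.1 hAB (f.symm j).2 (h ▸ (g.symm i).2)
    · simpa using Subtype.ext h
  · rintro (i | i) (j | j)
    · change G.Adj (f.symm i : V) (f.symm j) ↔ _
      simpa [oneSubdivision] using hA _ (f.symm i).2 _ (f.symm j).2
    · change G.Adj (f.symm i : V) (g.symm j) ↔ _
      simp [oneSubdivision]
    · change G.Adj (g.symm i : V) (f.symm j) ↔ _
      simp [oneSubdivision, G.adj_comm]
    · change G.Adj (g.symm i : V) (g.symm j) ↔ _
      simpa [oneSubdivision] using hB _ (g.symm i).2 _ (g.symm j).2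

variable {V : Type*} [Fintype V] [DecidableEq V] {G : SimpleGraph V} [DecidableRel G.Adj]
  {q : ℕ} [NeZero q]

theorem sum_card_subdivisionVertices (s : ℕ) :
    ∑ f : V → Fin q, #(subdivisionVertices G s f) =
      ∑ v : V, #(univ.filter fun f : V → Fin q => v ∈ subdivisionVertices G s f) := by
  have := sum_card_bipartiteAbove_eq_sum_card_bipartiteBelow
    (s := (univ : Finset (V → Fin q))) (t := (univ : Finset V))
    fun f v => v ∈ subdivisionVertices G s f
  simpa [bipartiteAbove, bipartiteBelow] using this

theorem sum_card_adj_subdivisionVertices (s : ℕ) :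
    ∑ f : V → Fin q, #((subdivisionVertices G s f ×ˢ subdivisionVertices G s f).filter
        fun p => G.Adj p.1 p.2) =
      ∑ u : V, ∑ v ∈ G.neighborFinset u, #(univ.filter fun f : V → Fin q =>
        u ∈ subdivisionVertices G s f ∧ v ∈ subdivisionVertices G s f) := by
  have := sum_card_bipartiteAbove_eq_sum_card_bipartiteBelow
    (s := (univ : Finset (V → Fin q))) (t := univ.filter fun p : V × V => G.Adj p.1 p.2)
    fun f p => p.1 ∈ subdivisionVertices G s f ∧ p.2 ∈ subdivisionVertices G s f
  simp only [bipartiteAbove, bipartiteBelow] at this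
  convert this using 1
  · refine sum_congr rfl fun f _ => congrArg card ?_
    ext p
    simp only [mem_filter, mem_product, mem_univ, true_and]
    tauto
  · rw [sum_filter, Fintype.sum_prod_type]
    refine sum_congr rfl fun u _ => ?_
    rw [← sum_filter]
    refine sum_congr ?_ fun _ _ => rfl
    ext v
    simp

/-- The first-moment argument for the sampled 1-subdivision. -/
theorem exists_subdivision_of_moments [Nonempty V] {s : ℕ} {a e D κ : ℝ} (hD : 0 < D) (hκ : 0 ≤ κ)
    (hA : (q : ℝ) ^ Fintype.card V * (Fintype.card V * a) ≤
      ∑ f : V → Fin q, (#(subdivisionVertices G s f) : ℝ))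
    (hE : ∑ f : V → Fin q, (#((subdivisionVertices G s f ×ˢ subdivisionVertices G s f).filter
        fun p => G.Adj p.1 p.2) : ℝ) ≤ (q : ℝ) ^ Fintype.card V * (Fintype.card V * e))
    (h : (D + 1) * κ * (q : ℝ)⁻¹ + e / D < a) :
    ∃ A B : Finset V, Disjoint A B ∧ (∀ x ∈ A, ∀ y ∈ A, ¬ G.Adj x y) ∧
      (∀ x ∈ B, ∀ y ∈ B, ¬ G.Adj x y) ∧ (∀ x ∈ A, #(B.filter fun y => G.Adj x y) = s) ∧
      κ * #B < #A := by
  have hq0 : (0 : ℝ) < q := Nat.cast_pos.2 (NeZero.pos q)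
  have hn : (0 : ℝ) < Fintype.card V := Nat.cast_pos.2 Fintype.card_pos
  have hB : ∑ f : V → Fin q, (#(univ.filter fun v => f v = 0) : ℝ) =
      (q : ℝ) ^ Fintype.card V * (Fintype.card V * (q : ℝ)⁻¹) := by
    have h1 := sum_card_bipartiteAbove_eq_sum_card_bipartiteBelow
      (s := (univ : Finset (V → Fin q))) (t := (univ : Finset V)) fun f v => f v = 0
    simp only [bipartiteAbove, bipartiteBelow] at h1
    rw [← Nat.cast_sum, h1, Nat.cast_sum]
    have h2 : ∀ v : V, (#(univ.filter fun f : V → Fin q => f v = 0) : ℝ) =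
        (q : ℝ) ^ Fintype.card V * (q : ℝ)⁻¹ := by
      intro v
      simpa using card_filter_forall_eq_zero (q := q) ({v} : Finset V)
    rw [sum_congr rfl fun v _ => h2 v, sum_const, card_univ, nsmul_eq_mul]
    ring
  obtain ⟨f, -, hf⟩ : ∃ f ∈ (univ : Finset (V → Fin q)),
      (D + 1) * κ * #(univ.filter fun v => f v = 0) +
        #((subdivisionVertices G s f ×ˢ subdivisionVertices G s f).filter
          fun p => G.Adj p.1 p.2) / D < (#(subdivisionVertices G s f) : ℝ) := by
    refine exists_lt_of_sum_lt ?_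
    rw [sum_add_distrib, ← mul_sum, ← sum_div, hB]
    refine lt_of_lt_of_le ?_ hA
    have hpos : 0 < (q : ℝ) ^ Fintype.card V * Fintype.card V := by positivity
    have h1 := div_le_div_of_nonneg_right hE hD.le
    have h2 := mul_lt_mul_of_pos_left h hpos
    have h3 : (q : ℝ) ^ Fintype.card V * (Fintype.card V * e) / D =
        (q : ℝ) ^ Fintype.card V * Fintype.card V * (e / D) := by ring
    rw [h3] at h1
    nlinarith
  obtain ⟨I, hIA, hI, hcard⟩ := exists_indep_subset_of_card_adj_pairs (G := G)
    (subdivisionVertices G s f) hD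
  refine ⟨I, univ.filter fun x => f x = 0 ∧ ∀ y, G.Adj x y → f y ≠ 0, ?_, hI, ?_, ?_, ?_⟩
  · refine disjoint_left.2 fun x hx hx' => ?_
    exact (mem_subdivisionVertices.1 (hIA hx)).1 (mem_filter.1 hx').2.1
  · intro x hx y hy hxy
    exact (mem_filter.1 hx).2.2 y hxy (mem_filter.1 hy).2.1
  · intro x hx
    obtain ⟨-, h2, h3⟩ := mem_subdivisionVertices.1 (hIA hx)
    rw [← h2]
    congr 1
    ext y
    simp only [mem_filter, mem_univ, true_and, SimpleGraph.mem_neighborFinset]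
    exact ⟨fun hy => ⟨hy.2, hy.1.1⟩, fun hy => ⟨⟨hy.2, h3 y hy.1 hy.2⟩, hy.1⟩⟩
  · have hle : (#(univ.filter fun x => f x = 0 ∧ ∀ y, G.Adj x y → f y ≠ 0) : ℝ) ≤
        #(univ.filter fun v => f v = 0) := by
      refine Nat.cast_le.2 (card_le_card fun x hx => ?_)
      exact mem_filter.2 ⟨mem_univ _, (mem_filter.1 hx).2.1⟩
    have h1 : (D + 1) * (κ * #(univ.filter fun v => f v = 0)) < (D + 1) * #I := by linarith
    have h2 := lt_of_mul_lt_mul_left h1 (by linarith)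
    exact (mul_le_mul_of_nonneg_left hle hκ).trans_lt h2

end Assembly

section AlmostRegular

/-- A lower bound on the small power `y` of the average degree for which the argument works. -/
noncomputable def sizeBound (s : ℕ) : ℝ := 16 * (s + 2) * (4 * 8 ^ s * s.factorial) ^ 2 + 1

theorem sizeBound_ge (s : ℕ) : 256 * ((s : ℝ) + 2) ≤ sizeBound s := by
  have h1 : (1 : ℝ) ≤ 8 ^ s := one_le_pow₀ (by norm_num)
  have h2 : (1 : ℝ) ≤ s.factorial := by exact_mod_cast s.factorial_pos
  have h3 : (4 : ℝ) ≤ 4 * 8 ^ s * s.factorial := by nlinarith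
  have h4 : (16 : ℝ) ≤ (4 * 8 ^ s * s.factorial : ℝ) ^ 2 := by nlinarith
  have h5 : (0 : ℝ) ≤ s := s.cast_nonneg
  unfold sizeBound
  nlinarith

/-- The choice of the degree threshold in the sampling argument. -/
theorem threshold_inequality {s : ℕ} (hs : 2 ≤ s) {y M w p K : ℝ} (hy : 1 ≤ y) (hK : 1 ≤ K)
    (hyK : 16 * (s + 2) * K ^ 2 < y) (hM : 0 < M) (hw : 0 < w) (hp : M * p = w)
    (hwy : w * y ^ (5 * s) ≤ 1) (hMw : 1 ≤ M * w ^ s) :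
    (4 * (s + 2) * K * M * w ^ s * y ^ (s + 1) + 1) * y ^ (2 * s - 1) * p +
      (s + 2) * M * w ^ (2 * s) / (4 * (s + 2) * K * M * w ^ s * y ^ (s + 1)) <
        w ^ s / (K * y ^ (s + 1)) := by
  have hy0 : 0 < y := by linarith
  have hK0 : 0 < K := by linarith
  have hp0 : 0 < p := by
    rw [← hp] at hw
    exact pos_of_mul_pos_right hw hM.le
  have hs0 : (0 : ℝ) ≤ s := s.cast_nonneg
  set D := 4 * (s + 2) * K * M * w ^ s * y ^ (s + 1) with hD
  have hy1 : 1 ≤ y ^ (s + 1) := one_le_pow₀ hy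
  have hD1 : 1 ≤ D := by
    have h1 : 1 ≤ 4 * ((s : ℝ) + 2) * K := by nlinarith
    have h2 : D = (4 * (s + 2) * K) * (M * w ^ s) * y ^ (s + 1) := by rw [hD]; ring
    rw [h2]
    exact one_le_mul_of_one_le_of_one_le (one_le_mul_of_one_le_of_one_le h1 hMw) hy1
  have hquot : (s + 2) * M * w ^ (2 * s) / D = w ^ s / (K * y ^ (s + 1)) / 4 := by
    rw [hD, two_mul s, pow_add]
    field_simp
  rw [hquot]
  have hfirst : (D + 1) * y ^ (2 * s - 1) * p ≤ 2 * D * y ^ (2 * s - 1) * p := by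
    gcongr
    linarith
  have hmain : 2 * D * y ^ (2 * s - 1) * p < w ^ s / (K * y ^ (s + 1)) / 2 := by
    rw [div_div, lt_div_iff₀ (by positivity)]
    have h1 : 2 * D * y ^ (2 * s - 1) * p * (K * y ^ (s + 1) * 2) =
        w ^ s * (16 * (s + 2) * K ^ 2 * (w * (y ^ (s + 1) * y ^ (s + 1) * y ^ (2 * s - 1)))) := by
      rw [hD, ← hp]
      ring
    have h2 : y ^ (s + 1) * y ^ (s + 1) * y ^ (2 * s - 1) * y ≤ y ^ (5 * s) := by
      rw [← pow_add, ← pow_add, ← pow_succ]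
      exact pow_le_pow_right₀ hy (by omega)
    have h3 : w * (y ^ (s + 1) * y ^ (s + 1) * y ^ (2 * s - 1)) * y ≤ 1 := by
      refine le_trans ?_ hwy
      rw [mul_assoc]
      gcongr
    rw [h1]
    have h4 : 16 * (s + 2) * K ^ 2 * (w * (y ^ (s + 1) * y ^ (s + 1) * y ^ (2 * s - 1))) < 1 := by
      refine lt_of_lt_of_le ?_ h3
      rw [mul_comm]
      gcongr
    have h5 : 0 < w ^ s := by positivity
    nlinarith
  linarith [show 0 < w ^ s / (K * y ^ (s + 1)) by positivity]

variable {V : Type*} [Fintype V] [DecidableEq V] {G : SimpleGraph V} [DecidableRel G.Adj]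

/-- Vertices of large degree have many independent `s`-sets in their neighbourhood. -/
theorem pow_le_card_indepSubsets_neighborFinset {s : ℕ} {d M w : ℝ} (v : V)
    (U : Finset V) (hU : ∀ x ∈ G.neighborFinset v \ U,
      (#(G.neighborFinset x ∩ G.neighborFinset v) : ℝ) ≤ w * M)
    (hUc : (#U : ℝ) ≤ d / 8) (hd : d / 2 ≤ G.degree v) (hd0 : 0 ≤ d) (hwM : 0 ≤ w * M)
    (hsw : s * (w * M + 1) ≤ d / 4) :
    (d / 8) ^ s / s.factorial ≤ #(indepSubsets G s (G.neighborFinset v)) := by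
  set L := G.neighborFinset v \ U with hL
  have h1 := pow_le_factorial_mul_card_indepSubsets (G := G) (m := ⌊w * M⌋₊) L (fun x hx => by
    refine Nat.le_floor (le_trans (Nat.cast_le.2 (card_le_card fun y hy => ?_)) (hU x hx))
    obtain ⟨hyL, hxy⟩ := mem_filter.1 hy
    exact mem_inter.2 ⟨by simpa using hxy, (mem_sdiff.1 hyL).1⟩) s
  have h2 : (G.degree v : ℝ) ≤ #L + #U := by
    rw [← SimpleGraph.card_neighborFinset_eq_degree]
    exact_mod_cast (card_le_card (by rw [hL, sdiff_union_self_eq_union]; exact subset_union_left)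
      |>.trans (card_union_le L U))
  have h3 : d / 8 ≤ ((#L - s * (⌊w * M⌋₊ + 1) : ℕ) : ℝ) := by
    have h4 : (#L : ℝ) ≤ ((#L - s * (⌊w * M⌋₊ + 1) : ℕ) : ℝ) + s * ((⌊w * M⌋₊ : ℝ) + 1) := by
      exact_mod_cast
        (le_tsub_add : #L ≤ #L - s * (⌊w * M⌋₊ + 1) + s * (⌊w * M⌋₊ + 1))
    have h5 : (s : ℝ) * ((⌊w * M⌋₊ : ℝ) + 1) ≤ s * (w * M + 1) := by
      gcongr
      exact Nat.floor_le hwM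
    linarith
  have h6 : indepSubsets G s L ⊆ indepSubsets G s (G.neighborFinset v) := by
    intro S hS
    rw [mem_indepSubsets] at hS ⊢
    exact ⟨⟨hS.1.1.trans sdiff_subset, hS.1.2⟩, hS.2⟩
  rw [div_le_iff₀ (by positivity)]
  calc (d / 8) ^ s ≤ ((#L - s * (⌊w * M⌋₊ + 1) : ℕ) : ℝ) ^ s := by gcongr
    _ ≤ s.factorial * #(indepSubsets G s L) := by exact_mod_cast h1
    _ ≤ s.factorial * #(indepSubsets G s (G.neighborFinset v)) := by
        gcongr
    _ = _ := mul_comm _ _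

set_option maxHeartbeats 1000000 in
/-- The almost regular case in terms of a small power `y` of the average degree. -/
theorem exists_subdivision_of_almost_regular [Nonempty V] {s t k : ℕ} (hs : 2 ≤ s) (hst : s ≤ t)
    (hk : G.cliqueNum ≤ k) (hG : IsEmpty (completeBipartiteGraph (Fin s) (Fin t) ↪g G))
    {y : ℝ} (hy : sizeBound s ≤ y) (hky : ((k : ℝ) + 1) ^ t ≤ y ^ (51 * s ^ 2))
    (hdeg : ∀ v, (G.degree v : ℝ) ≤ y ^ (50000 * s ^ 2) * y)
    (havg : Fintype.card V * y ^ (50000 * s ^ 2) ≤ ∑ v, (G.degree v : ℝ)) :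
    ∃ A B : Finset V, Disjoint A B ∧ (∀ x ∈ A, ∀ z ∈ A, ¬ G.Adj x z) ∧
      (∀ x ∈ B, ∀ z ∈ B, ¬ G.Adj x z) ∧ (∀ x ∈ A, #(B.filter fun z => G.Adj x z) = s) ∧
      y ^ (2 * s - 1) * #B < #A := by
  have hs0 : (2 : ℝ) ≤ s := by exact_mod_cast hs
  have hys : 256 * ((s : ℝ) + 2) ≤ y := (sizeBound_ge s).trans hy
  have hy1 : 1 ≤ y := by linarith
  have hy0 : 0 < y := by linarith
  have hs4 : 4 ≤ s ^ 2 := by nlinarith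
  have hss : s ≤ s ^ 2 := by nlinarith
  set d := y ^ (50000 * s ^ 2) with hd
  set M := d * y with hM
  set H := y ^ (20000 * s ^ 2) with hH
  have hd0 : 0 < d := by positivity
  have hM0 : 0 < M := by positivity
  have hM1 : 1 ≤ M := one_le_mul_of_one_le_of_one_le (one_le_pow₀ hy1) hy1
  have hdM : d ≤ M := le_mul_of_one_le_right hd0.le hy1
  set q := ⌈M * y ^ (5 * s)⌉₊ with hq
  have hqge : M * y ^ (5 * s) ≤ q := Nat.le_ceil _
  have hqpos : (0 : ℝ) < q := lt_of_lt_of_le (by positivity) hqge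
  have hqlt : (q : ℝ) ≤ 2 * (M * y ^ (5 * s)) := by
    have h1 : (q : ℝ) < M * y ^ (5 * s) + 1 := Nat.ceil_lt_add_one (by positivity)
    have h2 : 1 ≤ M * y ^ (5 * s) := one_le_mul_of_one_le_of_one_le hM1 (one_le_pow₀ hy1)
    linarith
  have : NeZero q := ⟨by exact_mod_cast hqpos.ne'⟩
  set w := M * (q : ℝ)⁻¹ with hw
  have hw0 : 0 < w := by positivity
  have hwy : w * y ^ (5 * s) ≤ 1 := by
    rw [hw, mul_right_comm, ← div_eq_mul_inv, div_le_one hqpos]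
    exact hqge
  have hwy' : 1 ≤ w * y ^ (6 * s) := by
    have h1 : 2 * y ^ (5 * s) ≤ y ^ (6 * s) := by
      calc 2 * y ^ (5 * s) ≤ y * y ^ (5 * s) := by gcongr; linarith
        _ = y ^ (5 * s + 1) := by ring
        _ ≤ _ := pow_le_pow_right₀ hy1 (by omega)
    rw [hw, mul_right_comm, ← div_eq_mul_inv, one_le_div hqpos]
    nlinarith
  have hwMq : w * M * q = M ^ 2 := by
    rw [hw]
    field_simp
  -- heavy neighbours
  set heavy : V → Finset V := fun v => (G.neighborFinset v).filter fun u =>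
    w * M < #(G.neighborFinset u ∩ G.neighborFinset v) with hheavy
  have hheavyc : ∀ v, (#(heavy v) : ℝ) ≤ H := by
    intro v
    have hbig : ((k : ℝ) + 1) ^ s + 1 ≤ M * (w * M / M) ^ (3 * s) := by
      rw [mul_div_cancel_right₀ _ hM0.ne']
      have h1 : 1 ≤ w ^ (3 * s) * y ^ (18 * s ^ 2) := by
        have := one_le_pow₀ hwy' (n := 3 * s)
        rw [mul_pow, ← pow_mul] at this
        rwa [show 6 * s * (3 * s) = 18 * s ^ 2 by ring] at this
      have h2 : ((k : ℝ) + 1) ^ s ≤ y ^ (51 * s ^ 2) :=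
        (pow_le_pow_right₀ (by linarith [k.cast_nonneg (α := ℝ)]) hst).trans hky
      have h3 : ((k : ℝ) + 1) ^ s + 1 ≤ y ^ (52 * s ^ 2) := by
        have h4 : 1 ≤ y ^ (51 * s ^ 2) := one_le_pow₀ hy1
        calc ((k : ℝ) + 1) ^ s + 1 ≤ y * y ^ (51 * s ^ 2) := by nlinarith
          _ = y ^ (51 * s ^ 2 + 1) := by ring
          _ ≤ _ := pow_le_pow_right₀ hy1 (by omega)
      calc ((k : ℝ) + 1) ^ s + 1 ≤ y ^ (52 * s ^ 2) * (w ^ (3 * s) * y ^ (18 * s ^ 2)) :=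
            h3.trans (le_mul_of_one_le_right (by positivity) h1)
        _ = y ^ (70 * s ^ 2) * w ^ (3 * s) := by ring
        _ ≤ d * w ^ (3 * s) := by
            gcongr
            exact pow_le_pow_right₀ hy1 (by omega)
        _ ≤ _ := by gcongr
    have h := card_pow_le_of_le_card_filter_adj hk (by omega) hG (heavy v) (G.neighborFinset v) hM0
      (by positivity : 0 ≤ w * M) (by simpa using hdeg v) (fun u hu => by
        refine ((mem_filter.1 hu).2.le).trans (Nat.cast_le.2 (card_le_card fun x hx => ?_))
        obtain ⟨hxu, hxv⟩ := mem_inter.1 hx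
        exact mem_filter.2 ⟨hxv, by simpa using hxu⟩) hbig
    refine le_of_pow_le_pow_left₀ (n := 3 * s) (by omega) (by positivity) (h.trans ?_)
    calc M ^ s * (((k : ℝ) + 1) ^ t) ^ (3 * s)
        ≤ (y ^ (50001 * s ^ 2)) ^ s * (y ^ (51 * s ^ 2)) ^ (3 * s) := by
          gcongr
          rw [hM, hd, ← pow_succ]
          exact pow_le_pow_right₀ hy1 (by omega)
      _ = y ^ (50154 * (s ^ 2 * s)) := by ring
      _ ≤ y ^ (60000 * (s ^ 2 * s)) := pow_le_pow_right₀ hy1 (by gcongr; norm_num)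
      _ = _ := by rw [hH]; ring
  have hHd : H * y ^ (6 * s ^ 2) ≤ d := by
    rw [hH, hd, ← pow_add]
    exact pow_le_pow_right₀ hy1 (by omega)
  have hHw : H ≤ M * w ^ s := by
    have h1 : 1 ≤ w ^ s * y ^ (6 * s ^ 2) := by
      have := one_le_pow₀ hwy' (n := s)
      rw [mul_pow, ← pow_mul] at this
      rwa [show 6 * s * s = 6 * s ^ 2 by ring] at this
    calc H ≤ H * (w ^ s * y ^ (6 * s ^ 2)) := le_mul_of_one_le_right (by positivity) h1
      _ = H * y ^ (6 * s ^ 2) * w ^ s := by ring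
      _ ≤ M * w ^ s := by gcongr; exact hHd.trans hdM
  have hH1 : 1 ≤ H := one_le_pow₀ hy1
  have hyd : H * y ≤ d := by
    refine le_trans ?_ hHd
    gcongr
    exact le_self_pow₀ hy1 (by omega)
  have hwM : w * M * y ≤ d := by
    have h1 : w * y ^ 2 ≤ 1 := by
      refine le_trans ?_ hwy
      gcongr
      omega
    calc w * M * y = d * (w * y ^ 2) := by rw [hM]; ring
      _ ≤ d := mul_le_of_le_one_right hd0.le h1
  have hsw : (s : ℝ) * (w * M + 1) ≤ d / 4 := by
    have h1 : w * M * (8 * s) ≤ w * M * y := by gcongr; linarith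
    have h2 : 1 * (8 * (s : ℝ)) ≤ H * y := mul_le_mul hH1 (by linarith) (by positivity) (by positivity)
    linarith
  set K : ℝ := 4 * 8 ^ s * s.factorial with hK
  have hK1 : 1 ≤ K := by
    have h1 : (1 : ℝ) ≤ 8 ^ s := one_le_pow₀ (by norm_num)
    have h2 : (1 : ℝ) ≤ s.factorial := by exact_mod_cast s.factorial_pos
    nlinarith
  -- vertices of large degree
  have hhigh : (Fintype.card V : ℝ) / (2 * y) ≤ #(univ.filter fun v => d / 2 ≤ G.degree v) := by
    have h1 : ∑ v, (G.degree v : ℝ) ≤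
        #(univ.filter fun v => d / 2 ≤ G.degree v) * M + Fintype.card V * (d / 2) := by
      rw [← sum_filter_add_sum_filter_not univ fun v => d / 2 ≤ (G.degree v : ℝ)]
      refine add_le_add ?_ ?_
      · rw [← nsmul_eq_mul]
        exact sum_le_card_nsmul _ _ _ fun v _ => hdeg v
      · refine (sum_le_card_nsmul _ _ (d / 2) fun v hv => (not_le.1 (mem_filter.1 hv).2).le).trans ?_
        rw [nsmul_eq_mul]
        gcongr
        exact card_le_univ _
    rw [div_le_iff₀ (by positivity)]
    refine le_of_mul_le_mul_right ?_ hd0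
    rw [hM] at h1
    linarith
  refine exists_subdivision_of_moments (q := q) (a := w ^ s / (K * y ^ (s + 1)))
    (e := (s + 2) * M * w ^ (2 * s)) (D := 4 * (s + 2) * K * M * w ^ s * y ^ (s + 1))
    (by positivity) (by positivity) ?_ ?_ ?_
  · rw [← Nat.cast_sum, sum_card_subdivisionVertices, Nat.cast_sum]
    have hq2 : 2 * (1 + ((s : ℝ) + 1) * M) ≤ q := by
      refine le_trans ?_ hqge
      have h1 : y ≤ y ^ (5 * s) := le_self_pow₀ hy1 (by omega)
      calc 2 * (1 + ((s : ℝ) + 1) * M) ≤ 2 * (s + 2) * M := by linarith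
        _ ≤ y * M := by gcongr; linarith
        _ = M * y := mul_comm _ _
        _ ≤ M * y ^ (5 * s) := by gcongr
    set g := (q : ℝ) ^ Fintype.card V * ((d / 8) ^ s / s.factorial * (q : ℝ)⁻¹ ^ s / 2) with hg
    have hlow : ∀ v ∈ univ.filter fun v => d / 2 ≤ (G.degree v : ℝ),
        g ≤ #(univ.filter fun f : V → Fin q => v ∈ subdivisionVertices G s f) := by
      intro v hv
      refine le_trans ?_ (le_card_filter_mem_subdivisionVertices hdeg hq2 v)
      rw [hg]
      gcongr
      refine pow_le_card_indepSubsets_neighborFinset v (heavy v) ?_ ?_ (mem_filter.1 hv).2 hd0.le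
        (by positivity) hsw
      · intro x hx
        obtain ⟨hxN, hxU⟩ := mem_sdiff.1 hx
        by_contra hcon
        exact hxU (mem_filter.2 ⟨hxN, not_le.1 hcon⟩)
      · refine (hheavyc v).trans ?_
        have h8 : H * 8 ≤ H * y := by gcongr; linarith
        linarith
    calc (q : ℝ) ^ Fintype.card V * (Fintype.card V * (w ^ s / (K * y ^ (s + 1))))
        = Fintype.card V / (2 * y) * g := by
          rw [hg, hK, hw, hM, mul_pow, mul_pow, div_pow, pow_succ y s]
          field_simp
          ring
      _ ≤ #(univ.filter fun v => d / 2 ≤ (G.degree v : ℝ)) * g := by gcongr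
      _ ≤ ∑ v ∈ univ.filter fun v => d / 2 ≤ (G.degree v : ℝ),
          (#(univ.filter fun f : V → Fin q => v ∈ subdivisionVertices G s f) : ℝ) := by
          rw [← nsmul_eq_mul]
          exact card_nsmul_le_sum _ _ _ hlow
      _ ≤ _ := sum_le_sum_of_subset_of_nonneg (filter_subset _ _) fun _ _ _ => by positivity
  · rw [← Nat.cast_sum, sum_card_adj_subdivisionVertices, Nat.cast_sum]
    have hvert : ∀ u ∈ (univ : Finset V),
        ((∑ v ∈ G.neighborFinset u, #(univ.filter fun f : V → Fin q =>
          u ∈ subdivisionVertices G s f ∧ v ∈ subdivisionVertices G s f) : ℕ) : ℝ) ≤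
        (q : ℝ) ^ Fintype.card V * ((s + 2) * M * w ^ (2 * s)) := by
      intro u _
      rw [Nat.cast_sum, ← sum_filter_add_sum_filter_not (G.neighborFinset u) fun v =>
        w * M < (#(G.neighborFinset v ∩ G.neighborFinset u) : ℝ)]
      have h1 : ∑ v ∈ heavy u, (#(univ.filter fun f : V → Fin q =>
          u ∈ subdivisionVertices G s f ∧ v ∈ subdivisionVertices G s f) : ℝ) ≤
          M * w ^ s * ((q : ℝ) ^ Fintype.card V * w ^ s) := by
        refine (sum_le_card_nsmul _ _ ((q : ℝ) ^ Fintype.card V * w ^ s) fun v _ => ?_).trans ?_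
        · refine le_trans (Nat.cast_le.2 (card_le_card fun f hf => ?_))
            (card_filter_mem_subdivisionVertices_le hdeg u)
          exact mem_filter.2 ⟨mem_univ _, (mem_filter.1 hf).2.1⟩
        · rw [nsmul_eq_mul]
          gcongr
          exact (hheavyc u).trans hHw
      have h2 : ∑ v ∈ (G.neighborFinset u).filter fun v =>
          ¬ w * M < (#(G.neighborFinset v ∩ G.neighborFinset u) : ℝ),
          (#(univ.filter fun f : V → Fin q =>
            u ∈ subdivisionVertices G s f ∧ v ∈ subdivisionVertices G s f) : ℝ) ≤
          M * ((q : ℝ) ^ Fintype.card V * ((s + 1) * w ^ (2 * s))) := by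
        refine (sum_le_card_nsmul _ _ ((q : ℝ) ^ Fintype.card V * ((s + 1) * w ^ (2 * s)))
          fun v hv => ?_).trans ?_
        · refine card_filter_mem_subdivisionVertices_pair_le hdeg u v ?_
          rw [← hwMq, inter_comm]
          gcongr
          exact not_lt.1 (mem_filter.1 hv).2
        · rw [nsmul_eq_mul]
          gcongr
          refine le_trans (Nat.cast_le.2 (card_filter_le _ _)) ?_
          simpa using hdeg u
      refine (add_le_add h1 h2).trans (le_of_eq ?_)
      ring
    refine (sum_le_card_nsmul _ _ _ hvert).trans (le_of_eq ?_)
    rw [card_univ, nsmul_eq_mul]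
    ring
  · refine threshold_inequality hs hy1 hK1 ?_ hM0 hw0 hw.symm hwy (hH1.trans hHw)
    have : sizeBound s = 16 * (s + 2) * K ^ 2 + 1 := rfl
    linarith

end AlmostRegular

section Degrees

variable {V : Type*} [Fintype V] (G : SimpleGraph V) [DecidableRel G.Adj]

theorem deg_eq_degree (v : V) : deg G v = G.degree v := by
  rw [deg, Set.ncard_eq_toFinset_card', ← SimpleGraph.card_neighborFinset_eq_degree,
    SimpleGraph.neighborFinset_def]

theorem card_mul_avgDeg [Nonempty V] :
    Fintype.card V * avgDeg G = ∑ v, (G.degree v : ℝ) := by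
  classical
  have hn : (Fintype.card V : ℝ) ≠ 0 := Nat.cast_ne_zero.2 Fintype.card_ne_zero
  rw [avgDeg, mul_div_cancel₀ _ hn, Set.ncard_eq_toFinset_card', ← Nat.cast_sum,
    SimpleGraph.sum_degrees_eq_twice_card_edges, SimpleGraph.edgeFinset]
  push_cast
  rfl

end Degrees

/-- Almost-regular case: for `t ≥ s ≥ 2` and large `k`, every
`K_{s,t}`-induced-free graph with clique number at most `k`, average degree
`d₀ ≥ k^(1000t)` and maximum degree at most `d₀^(1+ε₀)` (where `ε₀ = 1/(50000 s²)`)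
contains an induced 1-subdivision of an `s`-uniform multihypergraph of average degree at
least `c · d₀^(1/(40000 s))`. -/
theorem stmt15 :
    ∀ s t : ℕ, 2 ≤ s → s ≤ t → ∃ c : ℝ, 0 < c ∧ ∃ k₀ : ℕ, ∀ k : ℕ, k₀ ≤ k →
      ∀ (V : Type) [Fintype V] (G : SimpleGraph V) (d₀ : ℝ),
        G.cliqueNum ≤ k →
        avgDeg G = d₀ →
        d₀ ≥ (k : ℝ) ^ (1000 * t) →
        (∀ v : V, (deg G v : ℝ) ≤ d₀ ^ ((1 : ℝ) + 1 / (50000 * (s : ℝ) ^ 2))) →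
        IsEmpty (completeBipartiteGraph (Fin s) (Fin t) ↪g G) →
        ∃ (m n : ℕ) (edges : Fin m → Finset (Fin n)),
          (∀ e, (edges e).card = s) ∧
          ((s : ℝ) * m / n ≥ c * d₀ ^ ((1 : ℝ) / (40000 * (s : ℝ)))) ∧
          Nonempty (oneSubdivision edges ↪g G) := by
  intro s t hs hst
  refine ⟨1, one_pos, ⌈(sizeBound s + 2 ^ t) ^ (50000 * s ^ 2)⌉₊ + 1, ?_⟩
  intro k hk V _ G d₀ hω havg hd hdeg hG
  classical
  have hs0 : (0 : ℝ) < s := by exact_mod_cast (by omega : 0 < s)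
  have hs1 : (2 : ℝ) ≤ s := by exact_mod_cast hs
  have hk1 : (1 : ℝ) ≤ k := by exact_mod_cast (by omega : 1 ≤ k)
  have hkd : (k : ℝ) ≤ d₀ := (le_self_pow₀ hk1 (by omega)).trans hd
  have hd1 : 1 ≤ d₀ := hk1.trans hkd
  have hd0 : 0 < d₀ := by linarith
  have hV : Nonempty V := by
    by_contra hV
    rw [not_nonempty_iff] at hV
    simp [avgDeg] at havg
    linarith
  set y := d₀ ^ (1 / (50000 * (s : ℝ) ^ 2)) with hy
  have hy0 : 0 < y := Real.rpow_pos_of_pos hd0 _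
  have hyd : y ^ (50000 * s ^ 2) = d₀ := by
    rw [hy, ← Real.rpow_natCast, ← Real.rpow_mul hd0.le]
    push_cast
    rw [one_div_mul_cancel (by positivity), Real.rpow_one]
  have hsize : (0 : ℝ) < sizeBound s := lt_of_lt_of_le (by positivity) (sizeBound_ge s)
  have hyge : sizeBound s + 2 ^ t ≤ y := by
    refine le_of_pow_le_pow_left₀ (n := 50000 * s ^ 2) (by positivity) hy0.le ?_
    rw [hyd]
    refine (Nat.le_ceil _).trans (le_trans ?_ hkd)
    exact Nat.cast_le.2 ((Nat.le_succ _).trans hk)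
  have hy2 : (2 : ℝ) ^ t ≤ y := by linarith
  have hy1 : 1 ≤ y := (one_le_pow₀ one_le_two).trans hy2
  have hkt : (k : ℝ) ^ t ≤ y ^ (50 * s ^ 2) := by
    refine le_of_pow_le_pow_left₀ (n := 1000) (by norm_num) (by positivity) ?_
    rw [← pow_mul, ← pow_mul, mul_comm t, show 50 * s ^ 2 * 1000 = 50000 * s ^ 2 by ring, hyd]
    exact hd
  have hky : ((k : ℝ) + 1) ^ t ≤ y ^ (51 * s ^ 2) := by
    calc ((k : ℝ) + 1) ^ t ≤ (2 * k) ^ t := by gcongr; linarith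
      _ = 2 ^ t * (k : ℝ) ^ t := mul_pow _ _ _
      _ ≤ y * y ^ (50 * s ^ 2) := by gcongr
      _ = y ^ (50 * s ^ 2 + 1) := by ring
      _ ≤ y ^ (51 * s ^ 2) := pow_le_pow_right₀ hy1 (by nlinarith)
  obtain ⟨A, B, hAB, hA, hB, hsub, hcard⟩ := exists_subdivision_of_almost_regular hs hst hω hG
    (by linarith [pow_pos (two_pos (α := ℝ)) t]) hky
    (fun v => by
      rw [hyd, ← deg_eq_degree]
      refine (hdeg v).trans_eq ?_
      rw [Real.rpow_add hd0, Real.rpow_one])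
    (by rw [hyd, ← havg, card_mul_avgDeg])
  obtain ⟨edges, hedges, hemb⟩ := exists_oneSubdivision_embedding A B hAB hA hB hsub
  refine ⟨#A, #B, edges, hedges, ?_, hemb⟩
  have hA0 : 0 < #A := by
    have h1 : (0 : ℝ) < #A := lt_of_le_of_lt (by positivity) hcard
    exact_mod_cast h1
  have hB0 : (0 : ℝ) < #B := by
    obtain ⟨x, hx⟩ := card_pos.1 hA0
    have h1 : s ≤ #B := hsub x hx ▸ card_filter_le _ _
    exact_mod_cast (by omega : 0 < #B)
  have hexp : d₀ ^ ((1 : ℝ) / (40000 * (s : ℝ))) ≤ y ^ (2 * s - 1) := by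
    rw [hy, ← Real.rpow_natCast, ← Real.rpow_mul hd0.le]
    refine Real.rpow_le_rpow_of_exponent_le hd1 ?_
    rw [Nat.cast_sub (by omega)]
    push_cast
    rw [one_div_mul_eq_div, div_le_div_iff₀ (by positivity) (by positivity)]
    nlinarith
  rw [one_mul, ge_iff_le, le_div_iff₀ hB0]
  calc d₀ ^ ((1 : ℝ) / (40000 * (s : ℝ))) * #B ≤ y ^ (2 * s - 1) * #B := by gcongr
    _ ≤ #A := hcard.le
    _ ≤ s * #A := le_mul_of_one_le_left (by positivity) (by linarith)
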